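/- arXiv:2207.13903 — 2 statements merged into one kernel-verified Lean document; each statement's English description precedes it below -/
import Mathlib

section
/- Let k be a positive integer, let a_0, b_0 > 0 and a_1, …, a_k, b_1, …, b_k > 0, set a(x) = a_0·∏_{j=1}^k (x + a_j) and b(x) = b_0·∏_{j=1}^k (x + b_j) for x ≥ 0, and let {c(m)}_{m ∈ ℤ₊} be a sequence of positive real numbers. Assume (A1): b_1 ≤ a_1 ≤ b_2 ≤ a_2 ≤ … ≤ b_k ≤ a_k, and assume that the sequence {c(m)/a(m)}_{m ∈ ℤ₊} is a minimal completely monotone sequence. Then the double net {c(m)/(b(m) + a(m)·n)}_{m,n ∈ ℤ₊} is a minimal joint completely monotone net. -/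
noncomputable section

/-- Forward difference operator for sequences. -/
def dSeq (s : ℕ → ℝ) : ℕ → ℝ := fun m => s (m + 1) - s m

/-- A sequence is completely monotone. -/
def CompMono (s : ℕ → ℝ) : Prop := ∀ k m : ℕ, 0 ≤ (-1 : ℝ) ^ k * dSeq^[k] s m

/-- A completely monotone sequence is minimal. -/
def MinCompMono (s : ℕ → ℝ) : Prop :=
  CompMono s ∧ ∀ ε : ℝ, 0 < ε → ¬ CompMono (fun k => s k - if k = 0 then ε else 0)

/-- First forward difference operator for double nets. -/
def d1 (a : ℕ → ℕ → ℝ) : ℕ → ℕ → ℝ := fun m n => a (m + 1) n - a m n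

/-- Second forward difference operator for double nets. -/
def d2 (a : ℕ → ℕ → ℝ) : ℕ → ℕ → ℝ := fun m n => a m (n + 1) - a m n

/-- A double net is joint completely monotone. -/
def JointCompMono (a : ℕ → ℕ → ℝ) : Prop :=
  ∀ β₁ β₂ m n : ℕ, 0 ≤ (-1 : ℝ) ^ (β₁ + β₂) * d1^[β₁] (d2^[β₂] a) m n

/-- A joint completely monotone double net is minimal. -/
def MinJointCompMono (a : ℕ → ℕ → ℝ) : Prop :=
  JointCompMono a ∧
    (∀ ε : ℝ, 0 < ε → ¬ CompMono (fun k => a k 0 - if k = 0 then ε else 0)) ∧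
    (∀ ε : ℝ, 0 < ε → ¬ CompMono (fun k => a 0 k - if k = 0 then ε else 0))

open Filter Topology

/-- The negated forward difference operator, as a linear endomorphism of the space of
sequences. -/
def negDiff : Module.End ℝ (ℕ → ℝ) where
  toFun s m := s m - s (m + 1)
  map_add' s t := by ext m; simp only [Pi.add_apply]; ring
  map_smul' c s := by ext m; simp only [Pi.smul_apply, smul_eq_mul, RingHom.id_apply]; ring

lemma negDiff_apply (s : ℕ → ℝ) (m : ℕ) : negDiff s m = s m - s (m + 1) := rfl

lemma negDiff_pow_succ_apply (k : ℕ) (s : ℕ → ℝ) (m : ℕ) :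
    (negDiff ^ (k + 1)) s m = (negDiff ^ k) s m - (negDiff ^ k) s (m + 1) := by
  rw [pow_succ', Module.End.mul_apply, negDiff_apply]

lemma negDiff_pow_eq (k : ℕ) (s : ℕ → ℝ) (m : ℕ) :
    (negDiff ^ k) s m = (-1 : ℝ) ^ k * dSeq^[k] s m := by
  induction k generalizing m with
  | zero => simp
  | succ k ih =>
    rw [negDiff_pow_succ_apply, ih, ih, Function.iterate_succ_apply', dSeq]
    ring

lemma compMono_iff {s : ℕ → ℝ} : CompMono s ↔ ∀ k m, 0 ≤ (negDiff ^ k) s m := by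
  simp only [CompMono, negDiff_pow_eq]

lemma negDiff_pow_shift (k : ℕ) (s : ℕ → ℝ) (m : ℕ) :
    (negDiff ^ k) (fun i => s (i + 1)) m = (negDiff ^ k) s (m + 1) := by
  induction k generalizing m with
  | zero => rfl
  | succ k ih => rw [negDiff_pow_succ_apply, negDiff_pow_succ_apply, ih, ih]

lemma negDiff_mul (f g : ℕ → ℝ) :
    negDiff (f * g) = f * negDiff g + negDiff f * fun i => g (i + 1) := by
  ext m
  simp only [negDiff_apply, Pi.mul_apply, Pi.add_apply]
  ring

lemma tendsto_negDiff_pow {ι : Type*} {l : Filter ι} {F : ι → ℕ → ℝ} {f : ℕ → ℝ}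
    (h : ∀ m, Tendsto (fun i => F i m) l (𝓝 (f m))) (k m : ℕ) :
    Tendsto (fun i => (negDiff ^ k) (F i) m) l (𝓝 ((negDiff ^ k) f m)) := by
  induction k generalizing m with
  | zero => exact h m
  | succ k ih =>
    simp only [negDiff_pow_succ_apply]
    exact (ih m).sub (ih (m + 1))

namespace CompMono

variable {f g s : ℕ → ℝ}

lemma nonneg (hs : CompMono s) (m : ℕ) : 0 ≤ s m := by
  simpa using hs 0 m

lemma negDiff_pow (hs : CompMono s) (k : ℕ) : CompMono ((negDiff ^ k) s) := by
  rw [compMono_iff] at *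
  intro j m
  rw [← Module.End.mul_apply, ← pow_add]
  exact hs (j + k) m

lemma negDiff (hs : CompMono s) : CompMono (negDiff s) := by
  simpa using hs.negDiff_pow 1

lemma shift (hs : CompMono s) : CompMono (fun i => s (i + 1)) := by
  rw [compMono_iff] at *
  intro k m
  rw [negDiff_pow_shift]
  exact hs k (m + 1)

lemma add (hf : CompMono f) (hg : CompMono g) : CompMono (f + g) := by
  rw [compMono_iff] at *
  intro k m
  rw [map_add]
  exact add_nonneg (hf k m) (hg k m)

lemma smul {c : ℝ} (hc : 0 ≤ c) (hf : CompMono f) : CompMono (c • f) := by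
  rw [compMono_iff] at *
  intro k m
  rw [map_smul]
  exact mul_nonneg hc (hf k m)

lemma const {c : ℝ} (hc : 0 ≤ c) : CompMono (fun _ => c) := by
  rw [compMono_iff]
  rintro (_ | k) m
  · exact hc
  · have : _root_.negDiff (fun _ => c) = 0 := by ext; simp [negDiff_apply]
    rw [pow_succ, Module.End.mul_apply, this, map_zero, Pi.zero_apply]

lemma sum {ι : Type*} {S : Finset ι} {F : ι → ℕ → ℝ} (h : ∀ i ∈ S, CompMono (F i)) :
    CompMono (∑ i ∈ S, F i) :=
  Finset.sum_induction F CompMono (fun _ _ => add) (const le_rfl) h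

lemma mul (hf : CompMono f) (hg : CompMono g) : CompMono (f * g) := by
  rw [compMono_iff]
  intro k
  induction k generalizing f g with
  | zero => exact fun m => mul_nonneg (hf.nonneg m) (hg.nonneg m)
  | succ k ih =>
    intro m
    rw [pow_succ, Module.End.mul_apply, negDiff_mul, map_add]
    exact add_nonneg (ih hf hg.negDiff m) (ih hf.negDiff hg.shift m)

lemma prod {ι : Type*} {S : Finset ι} {F : ι → ℕ → ℝ} (h : ∀ i ∈ S, CompMono (F i)) :
    CompMono (∏ i ∈ S, F i) :=
  Finset.prod_induction F CompMono (fun _ _ => mul) (const zero_le_one) h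

lemma pow (hf : CompMono f) (n : ℕ) : CompMono (f ^ n) := by
  rw [← Finset.card_range n, ← Finset.prod_const]
  exact prod fun _ _ => hf

lemma of_tendsto {ι : Type*} {l : Filter ι} [l.NeBot] {F : ι → ℕ → ℝ}
    (hF : ∀ i, CompMono (F i)) (h : ∀ m, Tendsto (fun i => F i m) l (𝓝 (f m))) :
    CompMono f := by
  rw [compMono_iff]
  exact fun k m => ge_of_tendsto' (tendsto_negDiff_pow h k m)
    fun i => compMono_iff.1 (hF i) k m

lemma inv_one_sub (hf : CompMono f) (h : ∀ m, f m < 1) : CompMono (fun m => (1 - f m)⁻¹) := by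
  refine of_tendsto (l := atTop) (F := fun n => ∑ i ∈ Finset.range n, f ^ i)
    (fun n => sum fun i _ => hf.pow i) fun m => ?_
  simpa using (hasSum_geometric_of_lt_one (hf.nonneg m) (h m)).tendsto_sum_nat

lemma inv_sub {C : ℝ} (hC : 0 < C) (hf : CompMono f) (h : ∀ m, f m < C) :
    CompMono (fun m => (C - f m)⁻¹) := by
  have key : CompMono (fun m => (1 - (C⁻¹ • f) m)⁻¹) := by
    refine (hf.smul (inv_nonneg.2 hC.le)).inv_one_sub fun m => ?_
    rw [Pi.smul_apply, smul_eq_mul, inv_mul_lt_one₀ hC]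
    exact h m
  convert key.smul (inv_nonneg.2 hC.le) using 1
  ext m
  rw [Pi.smul_apply, Pi.smul_apply, smul_eq_mul, smul_eq_mul, ← mul_inv, mul_sub, mul_one,
    mul_inv_cancel_left₀ hC.ne']

lemma negDiff_pow_antitone (hs : CompMono s) (m : ℕ) :
    Antitone fun k => (_root_.negDiff ^ k) s m := by
  refine antitone_nat_of_succ_le fun k => ?_
  rw [negDiff_pow_succ_apply]
  linarith [compMono_iff.1 hs k (m + 1)]

lemma tendsto_negDiff_pow_shift (hs : CompMono s) :
    Tendsto (fun k => (_root_.negDiff ^ k) (fun i => s (i + 1)) 0) atTop (𝓝 0) := by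
  obtain ⟨L, hL⟩ : ∃ L, Tendsto (fun k => (_root_.negDiff ^ k) s 0) atTop (𝓝 L) :=
    ⟨_, tendsto_atTop_ciInf (hs.negDiff_pow_antitone 0)
      ⟨0, by rintro _ ⟨k, rfl⟩; exact compMono_iff.1 hs k 0⟩⟩
  have := hL.sub (hL.comp (tendsto_add_atTop_nat 1))
  rw [sub_self] at this
  refine this.congr fun k => ?_
  simp only [Function.comp_apply, negDiff_pow_shift, negDiff_pow_succ_apply]
  ring

end CompMono

lemma negDiff_pow_indicator_zero (k : ℕ) (ε : ℝ) :
    (negDiff ^ k) (fun i => if i = 0 then ε else 0) = fun i => if i = 0 then ε else 0 := by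
  induction k with
  | zero => rfl
  | succ k ih =>
    ext m
    rw [negDiff_pow_succ_apply, ih]
    simp

lemma compMono_sub_indicator_iff {s : ℕ → ℝ} (hs : CompMono s) (ε : ℝ) :
    CompMono (fun k => s k - if k = 0 then ε else 0) ↔ ∀ k, ε ≤ (negDiff ^ k) s 0 := by
  have h : ∀ k m, (negDiff ^ k) (fun i => s i - if i = 0 then ε else 0) m =
      (negDiff ^ k) s m - if m = 0 then ε else 0 := by
    intro k m
    have : (fun i => s i - if i = 0 then ε else 0) = s - fun i => if i = 0 then ε else 0 := rfl
    rw [this, map_sub, negDiff_pow_indicator_zero, Pi.sub_apply]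
  rw [compMono_iff]
  simp only [h]
  refine ⟨fun H k => by simpa using H k 0, fun H k m => ?_⟩
  rcases m with _ | m
  · simpa using H k
  · simpa using compMono_iff.1 hs k (m + 1)

lemma minCompMono_iff {s : ℕ → ℝ} :
    MinCompMono s ↔ CompMono s ∧ Tendsto (fun k => (negDiff ^ k) s 0) atTop (𝓝 0) := by
  refine and_congr_right fun hs => ?_
  simp only [compMono_sub_indicator_iff hs, not_forall, not_le]
  constructor
  · intro H
    rw [Metric.tendsto_atTop]
    intro ε hε
    obtain ⟨N, hN⟩ := H ε hε
    refine ⟨N, fun n hn => ?_⟩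
    rw [Real.dist_0_eq_abs, abs_of_nonneg (compMono_iff.1 hs n 0)]
    exact (hs.negDiff_pow_antitone 0 hn).trans_lt hN
  · exact fun H ε hε => (H.eventually_lt_const hε).exists

namespace MinCompMono

variable {f g s : ℕ → ℝ}

lemma tendsto (hs : MinCompMono s) : Tendsto (fun k => (negDiff ^ k) s 0) atTop (𝓝 0) :=
  (minCompMono_iff.1 hs).2

lemma add (hf : MinCompMono f) (hg : MinCompMono g) : MinCompMono (f + g) := by
  refine minCompMono_iff.2 ⟨hf.1.add hg.1, ?_⟩
  simpa only [map_add, Pi.add_apply, add_zero] using hf.tendsto.add hg.tendsto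

lemma smul {c : ℝ} (hc : 0 ≤ c) (hf : MinCompMono f) : MinCompMono (c • f) := by
  refine minCompMono_iff.2 ⟨hf.1.smul hc, ?_⟩
  simpa only [map_smul, Pi.smul_apply, smul_eq_mul, mul_zero] using hf.tendsto.const_mul c

lemma const {c : ℝ} (hc : 0 ≤ c) : MinCompMono (fun _ => c) :=
  minCompMono_iff.2 ⟨.const hc, (CompMono.const hc).tendsto_negDiff_pow_shift⟩

end MinCompMono

/-- A completely monotone sequence is the sum of the shift of a completely monotone sequence and
of one of its iterated differences. -/
lemma CompMono.exists_eq_shift_add {s : ℕ → ℝ} (hs : CompMono s) (N : ℕ) :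
    ∃ w, CompMono w ∧ s = (fun i => w (i + 1)) + (_root_.negDiff ^ N) s := by
  refine ⟨∑ i ∈ Finset.range N, (_root_.negDiff ^ i) s,
    CompMono.sum fun i _ => hs.negDiff_pow i, ?_⟩
  ext m
  simp only [Pi.add_apply, Finset.sum_apply]
  induction N with
  | zero => simp
  | succ N ih =>
    rw [Finset.sum_range_succ, negDiff_pow_succ_apply]
    linarith

lemma MinCompMono.mul {f g : ℕ → ℝ} (hf : MinCompMono f) (hg : MinCompMono g) :
    MinCompMono (f * g) := by
  have hfg := hf.1.mul hg.1
  refine minCompMono_iff.2 ⟨hfg, Metric.tendsto_atTop.2 fun ε hε => ?_⟩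
  have hlim : Tendsto (fun N => (negDiff ^ N) f 0 * g 0 + f 0 * (negDiff ^ N) g 0)
      atTop (𝓝 0) := by
    simpa using (hf.tendsto.mul_const (g 0)).add (hg.tendsto.const_mul (f 0))
  obtain ⟨N, hN⟩ := (hlim.eventually_lt_const (half_pos hε)).exists
  obtain ⟨w, hw, hfw⟩ := hf.1.exists_eq_shift_add N
  obtain ⟨z, hz, hgz⟩ := hg.1.exists_eq_shift_add N
  have hdecomp : f * g = (fun i => (w * z) (i + 1)) +
      ((negDiff ^ N) f * g + (fun i => w (i + 1)) * (negDiff ^ N) g) := by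
    calc f * g = ((fun i => w (i + 1)) + (negDiff ^ N) f) * g := by rw [← hfw]
      _ = (fun i => w (i + 1)) * ((fun i => z (i + 1)) + (negDiff ^ N) g) +
          (negDiff ^ N) f * g := by rw [← hgz, add_mul]
      _ = _ := by ext m; simp only [Pi.add_apply, Pi.mul_apply]; ring
  have hrem : CompMono ((negDiff ^ N) f * g + (fun i => w (i + 1)) * (negDiff ^ N) g) :=
    ((hf.1.negDiff_pow N).mul hg.1).add (hw.shift.mul (hg.1.negDiff_pow N))
  have hw1 : w 1 ≤ f 0 := by
    have h := congrFun hfw 0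
    simp only [Pi.add_apply, zero_add] at h
    linarith [compMono_iff.1 hf.1 N 0]
  obtain ⟨K, hK⟩ := eventually_atTop.1
    ((hw.mul hz).tendsto_negDiff_pow_shift.eventually_lt_const (half_pos hε))
  refine ⟨K, fun k hk => ?_⟩
  rw [Real.dist_0_eq_abs, abs_of_nonneg (compMono_iff.1 hfg k 0), hdecomp, map_add, Pi.add_apply]
  have h1 := hrem.negDiff_pow_antitone 0 k.zero_le
  simp only [pow_zero, Module.End.one_apply, Pi.add_apply, Pi.mul_apply, zero_add] at h1
  linarith [hK k hk, mul_le_mul_of_nonneg_right hw1 (compMono_iff.1 hg.1 N 0)]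

lemma MinCompMono.prod {ι : Type*} {S : Finset ι} {F : ι → ℕ → ℝ}
    (h : ∀ i ∈ S, MinCompMono (F i)) : MinCompMono (∏ i ∈ S, F i) :=
  Finset.prod_induction F MinCompMono (fun _ _ => mul) (const zero_le_one) h

lemma negDiff_pow_inv_add {t : ℝ} (ht : 0 < t) (k m : ℕ) :
    (negDiff ^ k) (fun n : ℕ => (t + n)⁻¹) m =
      k.factorial * ∏ i ∈ Finset.range (k + 1), (t + (m + i : ℕ))⁻¹ := by
  induction k generalizing m with
  | zero => simp
  | succ k ih =>
    rw [negDiff_pow_succ_apply, ih, ih, Finset.prod_range_succ (n := k + 1),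
      Finset.prod_range_succ' (n := k), Finset.prod_range_succ (n := k), Nat.factorial_succ,
      Finset.prod_congr rfl fun i (_ : i ∈ Finset.range k) =>
        show (t + (m + (i + 1) : ℕ))⁻¹ = (t + (m + 1 + i : ℕ))⁻¹ by congr 3; ring]
    generalize ∏ i ∈ Finset.range k, (t + (m + 1 + i : ℕ))⁻¹ = P
    have h1 : t + (m : ℝ) ≠ 0 := by positivity
    have h2 : t + ((m : ℝ) + 1 + k) ≠ 0 := by positivity
    push_cast
    rw [add_zero, ← add_assoc (m : ℝ) k 1, add_right_comm (m : ℝ) k 1]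
    field_simp
    ring

lemma minCompMono_inv_add {t : ℝ} (ht : 0 < t) : MinCompMono (fun n : ℕ => (t + n)⁻¹) := by
  refine minCompMono_iff.2 ⟨compMono_iff.2 fun k m => ?_, ?_⟩
  · rw [negDiff_pow_inv_add ht]
    positivity
  · have h := (Real.GammaSeq_tendsto_Gamma t).mul
      (tendsto_rpow_neg_atTop ht |>.comp tendsto_natCast_atTop_atTop)
    rw [mul_zero] at h
    refine h.congr' ?_
    filter_upwards [eventually_gt_atTop 0] with n hn
    have hn' : (n : ℝ) ^ t ≠ 0 := (Real.rpow_pos_of_pos (by positivity) t).ne'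
    rw [negDiff_pow_inv_add ht, Real.GammaSeq, Function.comp_apply, Real.rpow_neg (by positivity),
      Finset.prod_inv_distrib]
    simp only [zero_add]
    field_simp

lemma minCompMono_div_add {a b : ℝ} (hb : 0 < b) (hba : b ≤ a) :
    MinCompMono (fun n : ℕ => (n + a) / (n + b)) := by
  convert (MinCompMono.const zero_le_one).add
    ((minCompMono_inv_add hb).smul (sub_nonneg.2 hba)) using 1
  ext n
  have : (n : ℝ) + b ≠ 0 := by positivity
  simp only [Pi.add_apply, Pi.smul_apply, smul_eq_mul, add_comm b]
  field_simp
  ring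

/-- Partial fraction decomposition of a product of quotients of linear factors with interlacing
roots, allowing multiple roots. -/
lemma exists_prod_div_eq_one_sub_sum (A B : ℕ → ℝ) (k : ℕ)
    (hA : ∀ j, 1 ≤ j → j ≤ k → 0 < A j) (hBA : ∀ j, 1 ≤ j → j ≤ k → B j ≤ A j)
    (hAB : ∀ j, 1 ≤ j → j < k → A j ≤ B (j + 1)) :
    ∃ w : ℕ → ℝ, (∀ j ∈ Finset.Icc 1 k, 0 ≤ w j) ∧ ∀ x : ℝ, 0 ≤ x →
      ∏ j ∈ Finset.Icc 1 k, (x + B j) / (x + A j) =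
        1 - ∑ j ∈ Finset.Icc 1 k, w j * (A j + x)⁻¹ := by
  induction k with
  | zero => exact ⟨0, by simp, by simp⟩
  | succ k ih =>
    obtain ⟨w, hw, hprod⟩ := ih (fun j h1 h2 => hA j h1 (by lia))
      (fun j h1 h2 => hBA j h1 (by lia)) (fun j h1 h2 => hAB j h1 (by lia))
    have hle : ∀ j, 1 ≤ j → j ≤ k → A j ≤ B (k + 1) := by
      have hmono : ∀ j n, 1 ≤ j → j ≤ n → n ≤ k → A j ≤ B (n + 1) := by
        intro j n h1 h2
        induction n, h2 using Nat.le_induction with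
        | base => exact fun hk => hAB j h1 (by lia)
        | succ n hn ihn =>
          exact fun hk => (ihn (by lia)).trans
            ((hBA (n + 1) (by lia) (by lia)).trans (hAB (n + 1) (by lia) (by lia)))
      exact fun j h1 h2 => hmono j k h1 h2 le_rfl
    set a := A (k + 1) with ha
    set b := B (k + 1) with hb
    have hba : b ≤ a := hBA (k + 1) (by lia) le_rfl
    have ha0 : 0 < a := hA (k + 1) (by lia) le_rfl
    set α : ℕ → ℝ := fun j => (b - A j) / (a - A j)
    have hα0 : ∀ j ∈ Finset.Icc 1 k, 0 ≤ α j := fun j hj => by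
      rw [Finset.mem_Icc] at hj
      have := hle j hj.1 hj.2
      exact div_nonneg (by linarith) (by linarith)
    have hα1 : ∀ j ∈ Finset.Icc 1 k, α j ≤ 1 := fun j hj => by
      rw [Finset.mem_Icc] at hj
      have := hle j hj.1 hj.2
      exact div_le_one_of_le₀ (by linarith) (by linarith)
    have hαb : ∀ j ∈ Finset.Icc 1 k, α j * (a - A j) = b - A j := fun j hj => by
      rw [Finset.mem_Icc] at hj
      have := hle j hj.1 hj.2
      exact div_mul_cancel_of_imp fun h => by linarith
    refine ⟨fun j => if j = k + 1 then (a - b) + ∑ i ∈ Finset.Icc 1 k, w i * (1 - α i)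
      else w j * α j, fun j hj => ?_, fun x hx => ?_⟩
    · dsimp only
      split_ifs with h
      · exact add_nonneg (by linarith) (Finset.sum_nonneg fun i hi =>
          mul_nonneg (hw i hi) (by linarith [hα1 i hi]))
      · rw [Finset.mem_Icc] at hj
        have hj' : j ∈ Finset.Icc 1 k := Finset.mem_Icc.2 ⟨hj.1, by lia⟩
        exact mul_nonneg (hw j hj') (hα0 j hj')
    · have hif : ∀ j ∈ Finset.Icc 1 k, ∀ C : ℝ,
          (if j = k + 1 then C else w j * α j) * (A j + x)⁻¹ = w j * α j * (A j + x)⁻¹ :=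
        fun j hj C => by rw [if_neg (by rw [Finset.mem_Icc] at hj; lia)]
      dsimp only
      rw [Finset.prod_Icc_succ_top (by lia), Finset.sum_Icc_succ_top (by lia), hprod x hx,
        if_pos rfl, Finset.sum_congr rfl fun j hj => hif j hj _,
        ← ha, ← hb, sub_mul, Finset.sum_mul, one_mul]
      have hterm : ∀ j ∈ Finset.Icc 1 k, w j * (A j + x)⁻¹ * ((x + b) / (x + a)) =
          w j * α j * (A j + x)⁻¹ + w j * (1 - α j) * (a + x)⁻¹ := fun j hj => by
        have hAj : A j + x ≠ 0 := by
          rw [Finset.mem_Icc] at hj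
          have := hA j hj.1 (by lia)
          positivity
        have hax : x + a ≠ 0 := by positivity
        rw [add_comm a x]
        field_simp
        linear_combination -(w j) * hαb j hj
      rw [Finset.sum_congr rfl hterm, Finset.sum_add_distrib, ← Finset.sum_mul]
      have hlast : (x + b) / (x + a) = 1 - (a - b) * (a + x)⁻¹ := by
        have hax : x + a ≠ 0 := by positivity
        rw [add_comm a x]
        field_simp
        ring
      rw [hlast]
      ring

lemma jointCompMono_iff {a : ℕ → ℕ → ℝ} :
    JointCompMono a ↔ ∀ l n, CompMono fun m => (negDiff ^ l) (a m) n := by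
  have h2 : ∀ (l m n : ℕ), d2^[l] a m n = dSeq^[l] (a m) n := by
    intro l m n
    induction l generalizing n with
    | zero => rfl
    | succ l ih => simp only [Function.iterate_succ_apply', d2, dSeq, ih]
  have h1 : ∀ (F : ℕ → ℕ → ℝ) (l m n : ℕ), d1^[l] F m n = dSeq^[l] (fun i => F i n) m := by
    intro F l m n
    induction l generalizing m with
    | zero => rfl
    | succ l ih => simp only [Function.iterate_succ_apply', d1, dSeq, ih]
  have h : ∀ k l m n : ℕ, (-1 : ℝ) ^ (k + l) * d1^[k] (d2^[l] a) m n =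
      (negDiff ^ k) (fun i => (negDiff ^ l) (a i) n) m := by
    intro k l m n
    have : (fun i => (negDiff ^ l) (a i) n) = (-1 : ℝ) ^ l • fun i => d2^[l] a i n := by
      ext i
      rw [negDiff_pow_eq, Pi.smul_apply, smul_eq_mul, h2]
    rw [this, map_smul, Pi.smul_apply, negDiff_pow_eq, h1, smul_eq_mul]
    ring
  simp only [JointCompMono, compMono_iff, h]
  exact ⟨fun H l n k m => H k l m n, fun H k l m n => H l n k m⟩

lemma jointCompMono_mul_inv_add {s r : ℕ → ℝ} (hs : CompMono s) (hr : ∀ m, 0 < r m)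
    (h : ∀ p : ℕ, CompMono fun m => (r m + p)⁻¹) :
    JointCompMono fun m n => s m * (r m + n)⁻¹ := by
  refine jointCompMono_iff.2 fun l n => ?_
  convert hs.mul ((CompMono.prod (S := Finset.range (l + 1)) fun i _ => h (n + i)).smul
    (Nat.cast_nonneg l.factorial)) using 1
  ext m
  have : (fun n : ℕ => s m * (r m + n)⁻¹) = s m • fun n : ℕ => (r m + n)⁻¹ := rfl
  rw [this, map_smul, Pi.smul_apply, negDiff_pow_inv_add (hr m)]
  simp

theorem statement3 (k : ℕ) (hk : 0 < k) (a₀ b₀ : ℝ) (ha₀ : 0 < a₀) (hb₀ : 0 < b₀)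
    (A B : ℕ → ℝ)
    (hA : ∀ j, 1 ≤ j → j ≤ k → 0 < A j) (hB : ∀ j, 1 ≤ j → j ≤ k → 0 < B j)
    (c : ℕ → ℝ) (hc : ∀ m, 0 < c m)
    (hBA : ∀ j, 1 ≤ j → j ≤ k → B j ≤ A j)
    (hAB : ∀ j, 1 ≤ j → j < k → A j ≤ B (j + 1))
    (hca : MinCompMono (fun m => c m / (a₀ * ∏ j ∈ Finset.Icc 1 k, ((m : ℝ) + A j)))) :
    MinJointCompMono (fun m n =>
      c m / (b₀ * ∏ j ∈ Finset.Icc 1 k, ((m : ℝ) + B j) +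
        (a₀ * ∏ j ∈ Finset.Icc 1 k, ((m : ℝ) + A j)) * n)) := by
  set s : ℕ → ℝ := fun m => c m / (a₀ * ∏ j ∈ Finset.Icc 1 k, ((m : ℝ) + A j)) with hs
  set r : ℕ → ℝ := fun m => b₀ / a₀ * ∏ j ∈ Finset.Icc 1 k, ((m : ℝ) + B j) / (m + A j) with hr
  have hA' : ∀ m : ℕ, 0 < ∏ j ∈ Finset.Icc 1 k, ((m : ℝ) + A j) := fun m =>
    Finset.prod_pos fun j hj => by
      rw [Finset.mem_Icc] at hj
      linarith [hA j hj.1 hj.2, Nat.cast_nonneg (α := ℝ) m]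
  have hB' : ∀ m : ℕ, 0 < ∏ j ∈ Finset.Icc 1 k, ((m : ℝ) + B j) := fun m =>
    Finset.prod_pos fun j hj => by
      rw [Finset.mem_Icc] at hj
      linarith [hB j hj.1 hj.2, Nat.cast_nonneg (α := ℝ) m]
  have hr0 : ∀ m, 0 < r m := fun m => by
    rw [hr]
    dsimp only
    rw [Finset.prod_div_distrib]
    exact mul_pos (div_pos hb₀ ha₀) (div_pos (hB' m) (hA' m))
  have hnet : (fun m n : ℕ => c m / (b₀ * ∏ j ∈ Finset.Icc 1 k, ((m : ℝ) + B j) +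
      (a₀ * ∏ j ∈ Finset.Icc 1 k, ((m : ℝ) + A j)) * n)) = fun m n : ℕ => s m * (r m + n)⁻¹ := by
    ext m n
    simp only [hs, hr, Finset.prod_div_distrib]
    have h1 := (hA' m).ne'
    have h2 := hA' m
    have h3 := hB' m
    rw [div_mul_div_comm, div_add' _ _ _ (by positivity), inv_div, div_mul_div_comm,
      mul_comm (n : ℝ), mul_comm (c m), mul_div_mul_left _ _ (by positivity)]
  have hinv : MinCompMono fun m => (r m)⁻¹ := by
    convert (MinCompMono.prod fun j hj => minCompMono_div_add
      (hB j (Finset.mem_Icc.1 hj).1 (Finset.mem_Icc.1 hj).2)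
      (hBA j (Finset.mem_Icc.1 hj).1 (Finset.mem_Icc.1 hj).2)).smul
      (div_pos ha₀ hb₀).le using 1
    ext m
    simp [hr, mul_comm]
  obtain ⟨w, hw, hprod⟩ := exists_prod_div_eq_one_sub_sum A B k hA hBA hAB
  have hcm : ∀ p : ℕ, CompMono fun m => (r m + p)⁻¹ := by
    intro p
    have hq : CompMono ((b₀ / a₀) • ∑ j ∈ Finset.Icc 1 k, w j • fun m : ℕ => (A j + m)⁻¹) :=
      (CompMono.sum fun j hj => (minCompMono_inv_add
        (hA j (Finset.mem_Icc.1 hj).1 (Finset.mem_Icc.1 hj).2)).1.smul (hw j hj)).smul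
        (div_pos hb₀ ha₀).le
    have hrq : ∀ m, r m + p = (b₀ / a₀ + p) -
        ((b₀ / a₀) • ∑ j ∈ Finset.Icc 1 k, w j • fun m : ℕ => (A j + m)⁻¹) m := by
      intro m
      simp only [hr, hprod m (Nat.cast_nonneg m), Pi.smul_apply, Finset.sum_apply, smul_eq_mul]
      ring
    simp only [hrq]
    refine hq.inv_sub (by positivity) fun m => ?_
    linarith [hrq m, hr0 m, Nat.cast_nonneg (α := ℝ) p]
  rw [hnet]
  refine ⟨jointCompMono_mul_inv_add hca.1 hr0 hcm, ?_, ?_⟩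
  · simpa using (hca.mul hinv).2
  · exact ((minCompMono_inv_add (hr0 0)).smul (hca.1.nonneg 0)).2
end
end

section
/- Let k be a positive integer, let a_0, b_0 > 0 and a_1, …, a_k, b_1, …, b_k > 0, set a(x) = a_0·∏_{j=1}^k (x + a_j) and b(x) = b_0·∏_{j=1}^k (x + b_j) for x ≥ 0, and let {c(m)}_{m ∈ ℤ₊} be a sequence of positive real numbers such that {c(m)/a(m)}_{m ∈ ℤ₊} is completely monotone. If for every t ∈ (0,1) the sequence {t^{b(m)/a(m)}}_{m ∈ ℤ₊} is a Hausdorff moment sequence, then the double net {c(m)/(b(m) + a(m)·n)}_{m,n ∈ ℤ₊} is joint completely monotone. -/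
noncomputable section

/-- A sequence is a Hausdorff moment sequence: moments of a finite Borel measure on [0,1]. -/
def HausdorffMoment (s : ℕ → ℝ) : Prop :=
  ∃ μ : MeasureTheory.Measure ℝ, MeasureTheory.IsFiniteMeasure μ ∧
    μ (Set.Icc (0 : ℝ) 1)ᶜ = 0 ∧ ∀ m : ℕ, s m = ∫ t, t ^ m ∂μ

open MeasureTheory

theorem dSeq_iterate_add (k : ℕ) (s u : ℕ → ℝ) :
    dSeq^[k] (s + u) = dSeq^[k] s + dSeq^[k] u := by
  induction k generalizing s u with
  | zero => rfl
  | succ k ih =>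
    have h : dSeq (s + u) = dSeq s + dSeq u := by
      funext m
      simp only [dSeq, Pi.add_apply]
      ring
    rw [Function.iterate_succ_apply, Function.iterate_succ_apply, Function.iterate_succ_apply, h, ih]

theorem dSeq_iterate_const_mul (k : ℕ) (r : ℝ) (s : ℕ → ℝ) :
    dSeq^[k] (fun m => r * s m) = fun m => r * dSeq^[k] s m := by
  induction k generalizing s with
  | zero => rfl
  | succ k ih =>
    have h : dSeq (fun m => r * s m) = fun m => r * dSeq s m := by
      funext m
      simp only [dSeq]
      ring
    rw [Function.iterate_succ_apply, Function.iterate_succ_apply, h, ih]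

theorem dSeq_iterate_shift (k : ℕ) (s : ℕ → ℝ) :
    dSeq^[k] (fun m => s (m + 1)) = fun m => dSeq^[k] s (m + 1) := by
  induction k generalizing s with
  | zero => rfl
  | succ k ih =>
    rw [Function.iterate_succ_apply, Function.iterate_succ_apply, ← ih]
    rfl

theorem dSeq_iterate_pow (k : ℕ) (t : ℝ) :
    dSeq^[k] (fun m => t ^ m) = fun m => (t - 1) ^ k * t ^ m := by
  induction k with
  | zero => simp
  | succ k ih =>
    rw [Function.iterate_succ_apply', ih]
    funext m
    simp only [dSeq]
    ring

theorem CompMono.shift_s6 {s : ℕ → ℝ} (hs : CompMono s) : CompMono (fun m => s (m + 1)) := by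
  intro k m
  rw [dSeq_iterate_shift]
  exact hs k (m + 1)

theorem CompMono.neg_dSeq {s : ℕ → ℝ} (hs : CompMono s) : CompMono (fun m => -1 * dSeq s m) := by
  intro k m
  have h := hs (k + 1) m
  rw [Function.iterate_succ_apply, pow_succ] at h
  rw [dSeq_iterate_const_mul]
  linarith

theorem CompMono.mul_s6 {s u : ℕ → ℝ} (hs : CompMono s) (hu : CompMono u) :
    CompMono (fun m => s m * u m) := by
  intro k
  induction k generalizing s u with
  | zero =>
    intro m
    have h₁ := hs 0 m
    have h₂ := hu 0 m
    simp only [pow_zero, Function.iterate_zero, id, one_mul] at h₁ h₂ ⊢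
    exact mul_nonneg h₁ h₂
  | succ k ih =>
    intro m
    have h : dSeq (fun m => s m * u m) = fun m => -1 * ((fun m => (-1 * dSeq s m) * u m) +
        fun m => s (m + 1) * (-1 * dSeq u m)) m := by
      funext m
      simp only [dSeq, Pi.add_apply]
      ring
    have h₁ := ih hs.neg_dSeq hu m
    have h₂ := ih hs.shift_s6 hu.neg_dSeq m
    rw [Function.iterate_succ_apply, h, dSeq_iterate_const_mul, dSeq_iterate_add, pow_succ]
    simp only [Pi.add_apply]
    linarith

theorem CompMono.const_mul {s : ℕ → ℝ} (hs : CompMono s) {r : ℝ} (hr : 0 ≤ r) :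
    CompMono (fun m => r * s m) := by
  intro k m
  rw [dSeq_iterate_const_mul]
  have := mul_nonneg hr (hs k m)
  linarith

theorem compMono_pow {t : ℝ} (ht : t ∈ Set.Icc (0 : ℝ) 1) : CompMono (fun m => t ^ m) := by
  intro k m
  rw [dSeq_iterate_pow, ← mul_assoc, ← mul_pow]
  exact mul_nonneg (pow_nonneg (by linarith [ht.2]) _) (pow_nonneg ht.1 _)

theorem dSeq_iterate_integral {α : Type*} [MeasurableSpace α] {μ : Measure α}
    (k : ℕ) (F : α → ℕ → ℝ) (hF : ∀ m, Integrable (fun t => F t m) μ) :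
    (∀ m, Integrable (fun t => dSeq^[k] (F t) m) μ) ∧
      dSeq^[k] (fun m => ∫ t, F t m ∂μ) = fun m => ∫ t, dSeq^[k] (F t) m ∂μ := by
  induction k generalizing F with
  | zero => exact ⟨hF, rfl⟩
  | succ k ih =>
    have h : dSeq (fun m => ∫ t, F t m ∂μ) = fun m => ∫ t, dSeq (F t) m ∂μ := by
      funext m
      exact (integral_sub (hF (m + 1)) (hF m)).symm
    simp only [Function.iterate_succ_apply, h]
    exact ih (fun t => dSeq (F t)) fun m => (hF (m + 1)).sub (hF m)

theorem CompMono.integral {α : Type*} [MeasurableSpace α] {μ : Measure α}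
    {F : α → ℕ → ℝ} (hF : ∀ m, Integrable (fun t => F t m) μ) (h : ∀ᵐ t ∂μ, CompMono (F t)) :
    CompMono (fun m => ∫ t, F t m ∂μ) := by
  intro k m
  rw [(dSeq_iterate_integral k F hF).2, ← integral_const_mul]
  exact integral_nonneg_of_ae (h.mono fun t ht => ht k m)

theorem HausdorffMoment.compMono {s : ℕ → ℝ} (hs : HausdorffMoment s) : CompMono s := by
  obtain ⟨μ, hμ, h0, h⟩ := hs
  have hae : ∀ᵐ t ∂μ, t ∈ Set.Icc (0 : ℝ) 1 := h0
  rw [show s = fun m => ∫ t, t ^ m ∂μ from funext h]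
  refine CompMono.integral (fun m => ?_) (hae.mono fun t ht => compMono_pow ht)
  refine Integrable.of_bound (by fun_prop) 1 (hae.mono fun t ht => ?_)
  rw [Real.norm_of_nonneg (pow_nonneg ht.1 _)]
  exact pow_le_one₀ ht.1 ht.2

theorem d1_iterate_apply (k : ℕ) (a : ℕ → ℕ → ℝ) (m n : ℕ) :
    d1^[k] a m n = dSeq^[k] (fun i => a i n) m := by
  induction k generalizing a with
  | zero => rfl
  | succ k ih =>
    rw [Function.iterate_succ_apply, Function.iterate_succ_apply, ih]
    rfl

theorem d2_iterate_apply (k : ℕ) (a : ℕ → ℕ → ℝ) (m n : ℕ) :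
    d2^[k] a m n = dSeq^[k] (a m) n := by
  induction k generalizing a with
  | zero => rfl
  | succ k ih =>
    rw [Function.iterate_succ_apply, Function.iterate_succ_apply, ih]
    rfl

theorem jointCompMono_mul {s u : ℕ → ℝ} (hs : CompMono s) (hu : CompMono u) :
    JointCompMono (fun m n => s m * u n) := by
  intro p q m n
  have h : (fun i => dSeq^[q] (fun n => s i * u n) n) = fun i => dSeq^[q] u n * s i := by
    funext i
    rw [dSeq_iterate_const_mul, mul_comm]
  simp only [d1_iterate_apply, d2_iterate_apply]
  rw [h, dSeq_iterate_const_mul, pow_add]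
  have := mul_nonneg (hs p m) (hu q n)
  linarith

theorem JointCompMono.integral {α : Type*} [MeasurableSpace α] {μ : Measure α}
    {F : α → ℕ → ℕ → ℝ} (hF : ∀ m n, Integrable (fun t => F t m n) μ)
    (h : ∀ᵐ t ∂μ, JointCompMono (F t)) :
    JointCompMono (fun m n => ∫ t, F t m n ∂μ) := by
  intro p q m n
  have hq (i : ℕ) := dSeq_iterate_integral q (fun t => F t i) (hF i)
  simp only [d1_iterate_apply, d2_iterate_apply, (hq _).2]
  rw [(dSeq_iterate_integral p (fun t i => dSeq^[q] (F t i) n) fun i => (hq i).1 n).2,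
    ← integral_const_mul]
  refine integral_nonneg_of_ae (h.mono fun t ht => ?_)
  have h := ht p q m n
  simp only [d1_iterate_apply, d2_iterate_apply] at h
  exact h

theorem integrableOn_Ioo_rpow_sub_one {x : ℝ} (hx : 0 < x) :
    IntegrableOn (fun t : ℝ => t ^ (x - 1)) (Set.Ioo 0 1) :=
  (intervalIntegrable_iff_integrableOn_Ioo_of_le zero_le_one).1
    (intervalIntegral.intervalIntegrable_rpow' (by linarith))

theorem integral_Ioo_rpow_sub_one {x : ℝ} (hx : 0 < x) :
    ∫ t in Set.Ioo (0 : ℝ) 1, t ^ (x - 1) = 1 / x := by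
  rw [← integral_Ioc_eq_integral_Ioo, ← intervalIntegral.integral_of_le zero_le_one,
    integral_rpow (Or.inl (by linarith)), sub_add_cancel, Real.one_rpow, Real.zero_rpow hx.ne',
    sub_zero]

theorem jointCompMono_div_add {g r : ℕ → ℝ} (hg : CompMono g) (hr : ∀ m, 0 < r m)
    (h : ∀ t ∈ Set.Ioo (0 : ℝ) 1, CompMono (fun m => t ^ r m)) :
    JointCompMono (fun m n => g m / (r m + n)) := by
  have hpos (m n : ℕ) : 0 < r m + n := add_pos_of_pos_of_nonneg (hr m) n.cast_nonneg
  have hint : (fun m n : ℕ => g m / (r m + n)) =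
      fun m n : ℕ => ∫ t in Set.Ioo (0 : ℝ) 1, g m * t ^ (r m + n - 1) := by
    funext m n
    rw [integral_const_mul, integral_Ioo_rpow_sub_one (hpos m n), mul_one_div]
  rw [hint]
  refine JointCompMono.integral
    (fun m n => (integrableOn_Ioo_rpow_sub_one (hpos m n)).const_mul _) ?_
  filter_upwards [ae_restrict_mem measurableSet_Ioo] with t ht
  have heq : (fun m n : ℕ => g m * t ^ (r m + n - 1)) =
      fun m n : ℕ => (t⁻¹ * (g m * t ^ r m)) * t ^ n := by
    funext m n
    rw [Real.rpow_sub_one ht.1.ne', Real.rpow_add ht.1, Real.rpow_natCast]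
    ring
  rw [heq]
  exact jointCompMono_mul ((hg.mul_s6 (h t ht)).const_mul (inv_nonneg.2 ht.1.le))
    (compMono_pow ⟨ht.1.le, ht.2.le⟩)

theorem statement6 (k : ℕ) (hk : 0 < k) (a₀ b₀ : ℝ) (ha₀ : 0 < a₀) (hb₀ : 0 < b₀)
    (A B : ℕ → ℝ)
    (hA : ∀ j, 1 ≤ j → j ≤ k → 0 < A j) (hB : ∀ j, 1 ≤ j → j ≤ k → 0 < B j)
    (c : ℕ → ℝ) (hc : ∀ m, 0 < c m)
    (hca : CompMono (fun m => c m / (a₀ * ∏ j ∈ Finset.Icc 1 k, ((m : ℝ) + A j))))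
    (hH : ∀ t : ℝ, t ∈ Set.Ioo (0 : ℝ) 1 →
      HausdorffMoment (fun m =>
        t ^ ((b₀ * ∏ j ∈ Finset.Icc 1 k, ((m : ℝ) + B j)) /
          (a₀ * ∏ j ∈ Finset.Icc 1 k, ((m : ℝ) + A j))))) :
    JointCompMono (fun m n =>
      c m / (b₀ * ∏ j ∈ Finset.Icc 1 k, ((m : ℝ) + B j) +
        (a₀ * ∏ j ∈ Finset.Icc 1 k, ((m : ℝ) + A j)) * n)) := by
  have hprod {d : ℝ} {D : ℕ → ℝ} (hd : 0 < d) (hD : ∀ j, 1 ≤ j → j ≤ k → 0 < D j) (m : ℕ) :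
      0 < d * ∏ j ∈ Finset.Icc 1 k, ((m : ℝ) + D j) := by
    refine mul_pos hd (Finset.prod_pos fun j hj => ?_)
    rw [Finset.mem_Icc] at hj
    exact add_pos_of_nonneg_of_pos m.cast_nonneg (hD j hj.1 hj.2)
  have key := jointCompMono_div_add hca (fun m => div_pos (hprod hb₀ hB m) (hprod ha₀ hA m))
    fun t ht => (hH t ht).compMono
  convert key using 3 with m n
  have ha := (hprod ha₀ hA m).ne'
  rw [div_add' _ _ _ ha, div_div_div_cancel_right₀ ha, mul_comm (n : ℝ)]
end
end
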